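/- arXiv:1406.2520 — 2 statements merged into one kernel-verified Lean document; each statement's English description precedes it below -/
import Mathlib

section
/- Let (Ȳ_α, Ȳ_β) be a jointly Gaussian pair of random vectors, each standard Gaussian, of dimensions d_α and d_β, with cross-correlation matrix R = (E[Y_{α,i} Y_{β,j}])_{i,j}, and let s* be the largest singular value of R. Fix n ≥ 1 and let P_n(Ȳ_α) = Σ_{|k̄| = n} a_{α,k̄} :Ȳ_α^{k̄}:/√(k̄!) and P_n(Ȳ_β) = Σ_{|l̄| = n} a_{β,l̄} :Ȳ_β^{l̄}:/√(l̄!) be degree-n Wick polynomials with real coefficients. Then |E[P_n(Ȳ_α) · P_n(Ȳ_β)]| ≤ s* · ‖P_n(Ȳ_α)‖_2 · ‖P_n(Ȳ_β)‖_2. -/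
open MeasureTheory ProbabilityTheory
open scoped NNReal

/-- The `n`-th probabilists' Hermite polynomial, evaluated at a real `x`. -/
noncomputable def He (n : ℕ) (x : ℝ) : ℝ := Polynomial.aeval x (Polynomial.hermite n)

/-- `(Y₁, Y₂)` is a jointly centered Gaussian pair of random vectors: every linear combination
of all their coordinates has a centered Gaussian law. -/
def IsJointGaussianPair {Ω : Type*} [MeasurableSpace Ω] (μ : Measure Ω) {d₁ d₂ : ℕ}
    (Y₁ : Ω → Fin d₁ → ℝ) (Y₂ : Ω → Fin d₂ → ℝ) : Prop :=
  ∀ (c₁ : Fin d₁ → ℝ) (c₂ : Fin d₂ → ℝ), ∃ v : ℝ≥0,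
    Measure.map (fun ω => ∑ i, c₁ i * Y₁ ω i + ∑ j, c₂ j * Y₂ ω j) μ = gaussianReal 0 v

open MvPolynomial Matrix
open scoped MatrixOrder

lemma integrable_pow_gaussianReal (n : ℕ) : Integrable (fun x : ℝ => x ^ n) (gaussianReal 0 1) := by
  have h := (memLp_id_gaussianReal (μ := 0) (v := 1) (n : ℝ≥0)).integrable_norm_pow'
  refine (integrable_norm_iff (by fun_prop)).1 ?_
  simpa [norm_pow] using h

/-- Gaussian integration by parts for monomials. -/
lemma integral_pow_succ_gaussianReal (n : ℕ) :
    ∫ x, x ^ (n + 1) ∂(gaussianReal 0 1) = n * ∫ x, x ^ (n - 1) ∂(gaussianReal 0 1) := by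
  have hint (m : ℕ) : Integrable (fun x : ℝ => gaussianPDFReal 0 1 x * x ^ m) := by
    have h := integrable_pow_gaussianReal m
    rw [gaussianReal_of_var_ne_zero _ one_ne_zero,
      integrable_withDensity_iff_integrable_smul' (by fun_prop)
        (ae_of_all _ fun _ => gaussianPDF_lt_top)] at h
    simpa [toReal_gaussianPDF] using h
  have hφ (x : ℝ) : HasDerivAt (gaussianPDFReal 0 1) (-x * gaussianPDFReal 0 1 x) x := by
    have h1 : HasDerivAt (fun y : ℝ => -(y - 0) ^ 2 / (2 * ((1 : ℝ≥0) : ℝ))) (-x) x := by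
      have := (((hasDerivAt_id x).sub_const 0).pow 2).neg.div_const (2 * ((1 : ℝ≥0) : ℝ))
      refine this.congr_deriv ?_
      simp
      ring
    have h2 := h1.exp.const_mul (Real.sqrt (2 * Real.pi * ((1 : ℝ≥0) : ℝ)))⁻¹
    rw [gaussianPDFReal_def]
    refine h2.congr_deriv ?_
    ring
  have hzero : ∫ x : ℝ, (n * (gaussianPDFReal 0 1 x * x ^ (n - 1))
      - gaussianPDFReal 0 1 x * x ^ (n + 1)) = 0 := by
    refine integral_eq_zero_of_hasDerivAt_of_integrable
      (f := fun x => gaussianPDFReal 0 1 x * x ^ n) (fun x => ?_)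
      (((hint _).const_mul _).sub (hint _)) (hint n)
    refine ((hφ x).mul (hasDerivAt_pow n x)).congr_deriv ?_
    ring
  rw [integral_sub ((hint _).const_mul _) (hint _), integral_const_mul] at hzero
  rw [integral_gaussianReal_eq_integral_smul one_ne_zero,
    integral_gaussianReal_eq_integral_smul one_ne_zero]
  simp only [smul_eq_mul]
  linarith

section StdGaussian

variable {ι : Type*} [Fintype ι]

lemma integrable_eval_monomial_pi_gaussianReal (s : ι →₀ ℕ) (a : ℝ) :
    Integrable (fun g : ι → ℝ => eval g (monomial s a))
      (Measure.pi fun _ => gaussianReal 0 1) := by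
  simp only [eval_monomial, Finsupp.prod_pow]
  exact (Integrable.fintype_prod (f := fun i (x : ℝ) => x ^ s i)
    fun i => integrable_pow_gaussianReal (s i)).const_mul a

lemma integrable_eval_pi_gaussianReal (p : MvPolynomial ι ℝ) :
    Integrable (fun g : ι → ℝ => eval g p) (Measure.pi fun _ => gaussianReal 0 1) := by
  induction p using MvPolynomial.induction_on' with
  | monomial s a => exact integrable_eval_monomial_pi_gaussianReal s a
  | add p q hp hq => simp only [map_add]; exact hp.add hq

lemma integral_eval_monomial_pi_gaussianReal (s : ι →₀ ℕ) (a : ℝ) :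
    ∫ g : ι → ℝ, eval g (monomial s a) ∂(Measure.pi fun _ => gaussianReal 0 1)
      = a * ∏ i, ∫ x, x ^ s i ∂(gaussianReal 0 1) := by
  simp only [eval_monomial, Finsupp.prod_pow]
  rw [integral_const_mul, integral_fintype_prod_eq_prod (fun i (x : ℝ) => x ^ s i)]

/-- Gaussian integration by parts for polynomials in independent standard Gaussian variables. -/
lemma integral_X_mul_pi_gaussianReal (i : ι) (p : MvPolynomial ι ℝ) :
    ∫ g : ι → ℝ, eval g (X i * p) ∂(Measure.pi fun _ => gaussianReal 0 1)
      = ∫ g : ι → ℝ, eval g (pderiv i p) ∂(Measure.pi fun _ => gaussianReal 0 1) := by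
  classical
  induction p using MvPolynomial.induction_on' with
  | monomial s a =>
    rw [pderiv_monomial, X, monomial_mul, integral_eval_monomial_pi_gaussianReal,
      integral_eval_monomial_pi_gaussianReal, ← Finset.mul_prod_erase _ _ (Finset.mem_univ i),
      ← Finset.mul_prod_erase Finset.univ (fun j => ∫ x, x ^ (s - Finsupp.single i 1 : ι →₀ ℕ) j
        ∂(gaussianReal 0 1)) (Finset.mem_univ i)]
    have h (j) (hj : j ∈ Finset.univ.erase i) :
        (Finsupp.single i 1 + s : ι →₀ ℕ) j = (s - Finsupp.single i 1 : ι →₀ ℕ) j := by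
      have : i ≠ j := (Finset.ne_of_mem_erase hj).symm
      simp [this]
    rw [Finset.prod_congr rfl fun j hj => by rw [h j hj]]
    simp only [Finsupp.add_apply, Finsupp.single_eq_same, Finsupp.tsub_apply]
    rw [add_comm 1 (s i), integral_pow_succ_gaussianReal]
    ring
  | add p q hp hq =>
    simp only [mul_add, map_add]
    rw [integral_add (integrable_eval_pi_gaussianReal _) (integrable_eval_pi_gaussianReal _),
      integral_add (integrable_eval_pi_gaussianReal _) (integrable_eval_pi_gaussianReal _), hp, hq]

end StdGaussian

lemma pderiv_bind₁ {σ τ R : Type*} [CommSemiring R] [Fintype σ] (f : σ → MvPolynomial τ R)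
    (p : MvPolynomial σ R) (i : τ) :
    pderiv i (bind₁ f p) = ∑ j, bind₁ f (pderiv j p) * pderiv i (f j) := by
  classical
  induction p using MvPolynomial.induction_on with
  | C a => simp
  | add p q hp hq => simp [hp, hq, add_mul, Finset.sum_add_distrib]
  | mul_X p j hp =>
    simp only [map_mul, bind₁_X_right, pderiv_mul, hp, map_add, pderiv_X, add_mul,
      Finset.sum_add_distrib, Finset.sum_mul]
    congr 1
    · exact Finset.sum_congr rfl fun k _ => by ring
    · simp [Pi.single_apply, apply_ite, Finset.sum_ite_eq]

section JointGaussian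

variable {Ω ι : Type*} [MeasurableSpace Ω] {μ : Measure Ω} [IsProbabilityMeasure μ] [Fintype ι]
  [DecidableEq ι] {X : Ω → ι → ℝ}

/-- A centered jointly Gaussian family is distributed as a linear image of a standard one. -/
lemma exists_map_eq_map_pi_gaussianReal
    (hX : ∀ c : ι → ℝ, ∃ v : ℝ≥0, Measure.map (fun ω => ∑ i, c i * X ω i) μ = gaussianReal 0 v) :
    AEMeasurable X μ ∧ ∃ A : Matrix ι ι ℝ,
      (∀ i j, ∫ ω, X ω i * X ω j ∂μ = ∑ k, A i k * A j k) ∧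
      μ.map X = (Measure.pi fun _ => gaussianReal 0 1).map (fun g => A *ᵥ g) := by
  have hmeas (c : ι → ℝ) : AEMeasurable (fun ω => ∑ i, c i * X ω i) μ := by
    obtain ⟨v, hv⟩ := hX c
    refine AEMeasurable.of_map_ne_zero ?_
    rw [hv]
    exact IsProbabilityMeasure.ne_zero _
  have hmeasX : AEMeasurable X μ := by
    refine aemeasurable_pi_iff.2 fun i => ?_
    simpa [Pi.single_apply] using hmeas (Pi.single i 1)
  have hL2 (i : ι) : MemLp (fun ω => X ω i) 2 μ := by
    obtain ⟨v, hv⟩ := hX (Pi.single i 1)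
    have h := memLp_id_gaussianReal (μ := 0) (v := v) 2
    rw [← hv, memLp_map_measure_iff (by fun_prop) (hmeas _)] at h
    simpa [Pi.single_apply, Function.comp_def] using h
  set S : Matrix ι ι ℝ := Matrix.of fun i j => ∫ ω, X ω i * X ω j ∂μ with hS
  have hquad (c : ι → ℝ) : ∫ ω, (∑ i, c i * X ω i) ^ 2 ∂μ = c ⬝ᵥ S *ᵥ c := by
    have hint (i j : ι) : Integrable (fun ω => X ω i * X ω j) μ := (hL2 i).integrable_mul (hL2 j)
    have : ∀ ω, (∑ i, c i * X ω i) ^ 2 = ∑ i, ∑ j, (c i * c j) * (X ω i * X ω j) := fun ω => by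
      rw [sq, Finset.sum_mul_sum]
      exact Finset.sum_congr rfl fun i _ => Finset.sum_congr rfl fun j _ => by ring
    simp only [this]
    rw [integral_finsetSum _ fun i _ => integrable_finsetSum _ fun j _ => (hint i j).const_mul _]
    simp only [dotProduct, mulVec, hS, Matrix.of_apply, Finset.mul_sum]
    refine Finset.sum_congr rfl fun i _ => ?_
    rw [integral_finsetSum _ fun j _ => (hint i j).const_mul _]
    refine Finset.sum_congr rfl fun j _ => ?_
    rw [integral_const_mul]
    ring
  have hvar (c : ι → ℝ) : Measure.map (fun ω => ∑ i, c i * X ω i) μ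
      = gaussianReal 0 (c ⬝ᵥ S *ᵥ c).toNNReal := by
    obtain ⟨v, hv⟩ := hX c
    have h : (c ⬝ᵥ S *ᵥ c) = v := by
      rw [← hquad, ← variance_id_gaussianReal (μ := 0) (v := v), ← hv,
        variance_of_integral_eq_zero (by fun_prop)
          (by rw [hv]; exact integral_id_gaussianReal),
        integral_map (hmeas c) (by fun_prop)]
      rfl
    rw [hv, h, Real.toNNReal_coe]
  have hpos (c : ι → ℝ) : 0 ≤ c ⬝ᵥ S *ᵥ c := by
    rw [← hquad]
    positivity
  have hpsd : S.PosSemidef := by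
    refine Matrix.PosSemidef.of_dotProduct_mulVec_nonneg ?_ fun c => by simpa using hpos c
    ext i j
    simp [hS, mul_comm]
  set A := CFC.sqrt S with hA
  have hAself : Aᵀ = A := by
    have : IsSelfAdjoint A := (CFC.sqrt_nonneg S).isSelfAdjoint
    simpa [IsSelfAdjoint, Matrix.star_eq_conjTranspose] using this
  refine ⟨hmeasX, A, fun i j => ?_, ?_⟩
  · have h : A * Aᵀ = S := by rw [hAself]; exact CFC.sqrt_mul_sqrt_self S hpsd.nonneg
    have := congrFun (congrFun h i) j
    rw [Matrix.mul_apply] at this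
    simpa [hS] using this.symm
  have hlaw : (μ.map X).map (WithLp.toLp 2) = multivariateGaussian 0 S := by
    have : IsProbabilityMeasure (μ.map X) := Measure.isProbabilityMeasure_map hmeasX
    have : IsProbabilityMeasure ((μ.map X).map (WithLp.toLp 2)) :=
      Measure.isProbabilityMeasure_map (by fun_prop)
    refine Measure.ext_of_charFun (funext fun t => ?_)
    rw [charFun_multivariateGaussian hpsd, charFun_apply,
      integral_map (by fun_prop) (by fun_prop), integral_map hmeasX (by fun_prop)]
    have h1 := charFun_gaussianReal (μ := 0) (v := (t.ofLp ⬝ᵥ S *ᵥ t.ofLp).toNNReal) 1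
    rw [← hvar, charFun_apply_real, integral_map (hmeas _) (by fun_prop)] at h1
    simp only [Complex.ofReal_one, one_mul, PiLp.inner_apply, RCLike.inner_apply, conj_trivial,
      Real.coe_toNNReal _ (hpos t.ofLp), inner_zero_right, Complex.ofReal_zero, zero_mul,
      mul_zero, one_pow, mul_one] at h1 ⊢
    exact h1
  have hid : (WithLp.ofLp ∘ WithLp.toLp 2 : (ι → ℝ) → ι → ℝ) = id := rfl
  have h2 := congrArg (Measure.map (WithLp.ofLp)) hlaw
  rw [Measure.map_map (μ := μ.map X) (by fun_prop) (by fun_prop), hid, Measure.map_id,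
    multivariateGaussian, ← map_pi_eq_stdGaussian, Measure.map_map (by fun_prop) (by fun_prop),
    Measure.map_map (by fun_prop) (by fun_prop)] at h2
  rw [h2]
  congr 1
  funext g
  simp [← hA, Matrix.toEuclideanCLM_toLp]

omit [DecidableEq ι] in
lemma eval_mulVec (A : Matrix ι ι ℝ) (g : ι → ℝ) (p : MvPolynomial ι ℝ) :
    eval (A *ᵥ g) p = eval g (bind₁ (fun j => ∑ k, C (A j k) * MvPolynomial.X k) p) := by
  have h := aeval_bind₁ (S := ℝ) g (fun j => ∑ k, C (A j k) * MvPolynomial.X k) p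
  simp only [← coe_aeval_eq_eval, RingHom.coe_coe]
  rw [h]
  congr 2
  funext j
  simp [mulVec, dotProduct]

lemma integrable_eval_of_jointGaussian
    (hX : ∀ c : ι → ℝ, ∃ v : ℝ≥0, Measure.map (fun ω => ∑ i, c i * X ω i) μ = gaussianReal 0 v)
    (p : MvPolynomial ι ℝ) : Integrable (fun ω => eval (X ω) p) μ := by
  obtain ⟨hmeas, A, -, hmap⟩ := exists_map_eq_map_pi_gaussianReal hX
  have hp : AEStronglyMeasurable (fun x : ι → ℝ => eval x p) (μ.map X) :=
    (MvPolynomial.continuous_eval p).aestronglyMeasurable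
  refine (integrable_map_measure hp hmeas).1 ?_
  rw [hmap]
  refine (integrable_map_measure (MvPolynomial.continuous_eval p).aestronglyMeasurable
    (by fun_prop)).2 ?_
  simp only [Function.comp_def, eval_mulVec]
  exact integrable_eval_pi_gaussianReal _

/-- Gaussian integration by parts for polynomials in a centered jointly Gaussian family. -/
lemma integral_X_mul_of_jointGaussian
    (hX : ∀ c : ι → ℝ, ∃ v : ℝ≥0, Measure.map (fun ω => ∑ i, c i * X ω i) μ = gaussianReal 0 v)
    (i : ι) (p : MvPolynomial ι ℝ) :
    ∫ ω, X ω i * eval (X ω) p ∂μ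
      = ∑ j, (∫ ω, X ω i * X ω j ∂μ) * ∫ ω, eval (X ω) (pderiv j p) ∂μ := by
  obtain ⟨hmeas, A, hcov, hmap⟩ := exists_map_eq_map_pi_gaussianReal hX
  set f : ι → MvPolynomial ι ℝ := fun j => ∑ k, C (A j k) * MvPolynomial.X k with hf
  have htransfer (q : MvPolynomial ι ℝ) : ∫ ω, eval (X ω) q ∂μ
      = ∫ g : ι → ℝ, eval g (bind₁ f q) ∂(Measure.pi fun _ => gaussianReal 0 1) := by
    rw [← integral_map (f := fun x : ι → ℝ => eval x q) hmeas
      (MvPolynomial.continuous_eval q).aestronglyMeasurable, hmap,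
      integral_map (by fun_prop) (MvPolynomial.continuous_eval q).aestronglyMeasurable]
    simp only [eval_mulVec, hf]
  have hfd (j k : ι) : pderiv k (f j) = C (A j k) := by
    simp [hf, pderiv_X, Pi.single_apply]
  have hint := integrable_eval_pi_gaussianReal (ι := ι)
  calc ∫ ω, X ω i * eval (X ω) p ∂μ
      = ∫ ω, eval (X ω) (MvPolynomial.X i * p) ∂μ := by simp
    _ = ∫ g : ι → ℝ, ∑ k, A i k * eval g (MvPolynomial.X k * bind₁ f p)
          ∂(Measure.pi fun _ => gaussianReal 0 1) := by
        rw [htransfer]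
        refine integral_congr_ae (ae_of_all _ fun g => ?_)
        simp [hf, Finset.sum_mul, mul_assoc]
    _ = ∑ k, A i k * ∑ j, A j k * ∫ ω, eval (X ω) (pderiv j p) ∂μ := by
        rw [integral_finsetSum _ fun k _ => (hint _).const_mul _]
        refine Finset.sum_congr rfl fun k _ => ?_
        rw [integral_const_mul, integral_X_mul_pi_gaussianReal, pderiv_bind₁]
        simp only [hfd, map_sum, map_mul, eval_C]
        rw [integral_finsetSum _ fun j _ => (hint _).mul_const _]
        congr 1
        refine Finset.sum_congr rfl fun j _ => ?_
        rw [integral_mul_const, ← htransfer, mul_comm]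
    _ = ∑ j, (∫ ω, X ω i * X ω j ∂μ) * ∫ ω, eval (X ω) (pderiv j p) ∂μ := by
        simp only [Finset.mul_sum, hcov, Finset.sum_mul]
        rw [Finset.sum_comm]
        exact Finset.sum_congr rfl fun j _ => Finset.sum_congr rfl fun k _ => by ring

end JointGaussian

lemma derivative_hermite_succ (n : ℕ) :
    (Polynomial.hermite (n + 1)).derivative = (n + 1 : Polynomial ℤ) * Polynomial.hermite n := by
  induction n with
  | zero => simp [Polynomial.hermite_succ]
  | succ n ih =>
    have h := Polynomial.hermite_succ n
    rw [Polynomial.hermite_succ (n + 1)]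
    simp only [Polynomial.derivative_sub, Polynomial.derivative_mul, Polynomial.derivative_X, ih,
      Polynomial.derivative_add, Polynomial.derivative_natCast, Polynomial.derivative_one]
    push_cast
    rw [h]
    ring

/-- Hermite polynomials are eigenfunctions of the Ornstein–Uhlenbeck operator. -/
lemma X_mul_derivative_hermite_sub (n : ℕ) :
    (Polynomial.X * (Polynomial.hermite n).derivative
      - (Polynomial.hermite n).derivative.derivative : Polynomial ℤ)
      = (n : Polynomial ℤ) * Polynomial.hermite n := by
  cases n with
  | zero => simp
  | succ n =>
    rw [derivative_hermite_succ, Polynomial.hermite_succ]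
    simp only [Polynomial.derivative_mul, Polynomial.derivative_add,
      Polynomial.derivative_natCast, Polynomial.derivative_one]
    push_cast
    ring

section Wick

variable {ι : Type*} [Fintype ι]

/-- The multidimensional Wick polynomial with multi-index `k`. -/
noncomputable def wickPoly (k : ι → ℕ) : MvPolynomial ι ℝ :=
  ∏ i, Polynomial.aeval (MvPolynomial.X i) (Polynomial.hermite (k i))

lemma eval_wickPoly {d : ℕ} (k : Fin d → ℕ) (x : Fin d → ℝ) :
    eval x (wickPoly k) = ∏ i, He (k i) (x i) := by
  rw [wickPoly, map_prod]
  refine Finset.prod_congr rfl fun i _ => ?_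
  have h := Polynomial.aeval_algHom_apply
    ((aeval x : MvPolynomial (Fin d) ℝ →ₐ[ℝ] ℝ).restrictScalars ℤ) (MvPolynomial.X i)
    (Polynomial.hermite (k i))
  simp only [AlgHom.restrictScalars_apply, aeval_X] at h
  rw [He, h]
  exact (RingHom.congr_fun (coe_aeval_eq_eval x) _).symm

omit [Fintype ι] in
lemma pderiv_aeval_X (i j : ι) (p : Polynomial ℤ) :
    pderiv i (Polynomial.aeval (MvPolynomial.X j : MvPolynomial ι ℝ) p)
      = Polynomial.aeval (MvPolynomial.X j) p.derivative * pderiv i (MvPolynomial.X j) :=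
  ((pderiv i : Derivation ℝ (MvPolynomial ι ℝ) _).restrictScalars ℤ).map_aeval p (MvPolynomial.X j)

lemma ornsteinUhlenbeck_wickPoly (k : ι → ℕ) (i : ι) :
    MvPolynomial.X i * pderiv i (wickPoly k) - pderiv i (pderiv i (wickPoly k))
      = (k i : MvPolynomial ι ℝ) * wickPoly k := by
  classical
  have hrest (s : Finset ι) (hs : i ∉ s) : pderiv i
      (∏ j ∈ s, Polynomial.aeval (MvPolynomial.X j : MvPolynomial ι ℝ)
        (Polynomial.hermite (k j))) = 0 := by
    induction s using Finset.induction_on with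
    | empty => simp
    | insert j s hj ih =>
      rw [Finset.mem_insert, not_or] at hs
      rw [Finset.prod_insert hj, pderiv_mul, ih hs.2, pderiv_aeval_X,
        pderiv_X_of_ne (Ne.symm hs.1)]
      simp
  rw [wickPoly, ← Finset.mul_prod_erase _ _ (Finset.mem_univ i)]
  simp only [pderiv_mul, hrest _ (Finset.notMem_erase i _), pderiv_aeval_X,
    pderiv_X_self, mul_one, mul_zero, add_zero]
  have h := congrArg (Polynomial.aeval (MvPolynomial.X i : MvPolynomial ι ℝ))
    (X_mul_derivative_hermite_sub (k i))
  simp only [map_sub, map_mul, Polynomial.aeval_X, map_natCast] at h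
  rw [← mul_assoc (k i : MvPolynomial ι ℝ), ← h]
  ring

/-- A linear combination of Wick polynomials. -/
noncomputable def wickSum (K : Finset (ι → ℕ)) (c : (ι → ℕ) → ℝ) : MvPolynomial ι ℝ :=
  ∑ k ∈ K, C (c k) * wickPoly k

/-- Linear combinations of Wick polynomials of degree `n` are eigenvectors of the number
operator. -/
lemma ornsteinUhlenbeck_wickSum {n : ℕ} {K : Finset (ι → ℕ)} (hK : ∀ k ∈ K, ∑ i, k i = n)
    (c : (ι → ℕ) → ℝ) :
    ∑ i, (MvPolynomial.X i * pderiv i (wickSum K c) - pderiv i (pderiv i (wickSum K c)))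
      = (n : MvPolynomial ι ℝ) * wickSum K c := by
  simp only [wickSum, map_sum, pderiv_C_mul, Finset.mul_sum, ← Finset.sum_sub_distrib]
  rw [Finset.sum_comm]
  refine Finset.sum_congr rfl fun k hk => ?_
  have h (i : ι) : MvPolynomial.X i * (C (c k) * pderiv i (wickPoly k))
      - C (c k) * pderiv i (pderiv i (wickPoly k))
      = C (c k) * ((k i : MvPolynomial ι ℝ) * wickPoly k) := by
    rw [← ornsteinUhlenbeck_wickPoly]
    ring
  rw [Finset.sum_congr rfl fun i _ => h i, ← Finset.mul_sum, ← Finset.sum_mul, ← Nat.cast_sum,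
    hK k hk]
  ring

end Wick

namespace IsJointGaussianPair

variable {Ω : Type*} [MeasurableSpace Ω] {μ : Measure Ω} [IsProbabilityMeasure μ] {dα dβ : ℕ}
  {Yα : Ω → Fin dα → ℝ} {Yβ : Ω → Fin dβ → ℝ}

omit [IsProbabilityMeasure μ] in
lemma sumElim (h : IsJointGaussianPair μ Yα Yβ) (c : Fin dα ⊕ Fin dβ → ℝ) :
    ∃ v : ℝ≥0, Measure.map (fun ω => ∑ i, c i * Sum.elim (Yα ω) (Yβ ω) i) μ
      = gaussianReal 0 v := by
  simpa using h (c ∘ Sum.inl) (c ∘ Sum.inr)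

omit [IsProbabilityMeasure μ] in
lemma self_left (h : IsJointGaussianPair μ Yα Yβ) : IsJointGaussianPair μ Yα Yα := fun c₁ c₂ => by
  simpa [add_mul, Finset.sum_add_distrib] using h (c₁ + c₂) 0

omit [IsProbabilityMeasure μ] in
lemma self_right (h : IsJointGaussianPair μ Yα Yβ) : IsJointGaussianPair μ Yβ Yβ := fun c₁ c₂ => by
  simpa [add_mul, Finset.sum_add_distrib] using h 0 (c₁ + c₂)

lemma integrable_eval_mul_eval (h : IsJointGaussianPair μ Yα Yβ) (f : MvPolynomial (Fin dα) ℝ)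
    (g : MvPolynomial (Fin dβ) ℝ) : Integrable (fun ω => eval (Yα ω) f * eval (Yβ ω) g) μ := by
  have := integrable_eval_of_jointGaussian h.sumElim (rename Sum.inl f * rename Sum.inr g)
  simpa [eval_rename, Function.comp_def] using this

lemma integral_X_mul_eval_mul_eval (h : IsJointGaussianPair μ Yα Yβ)
    (hcov : ∀ i j, ∫ ω, Yα ω i * Yα ω j ∂μ = if i = j then 1 else 0)
    (i : Fin dα) (f : MvPolynomial (Fin dα) ℝ) (g : MvPolynomial (Fin dβ) ℝ) :
    ∫ ω, eval (Yα ω) (MvPolynomial.X i * f) * eval (Yβ ω) g ∂μ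
      = ∫ ω, eval (Yα ω) (pderiv i f) * eval (Yβ ω) g ∂μ
        + ∑ j, (∫ ω, Yα ω i * Yβ ω j ∂μ) * ∫ ω, eval (Yα ω) f * eval (Yβ ω) (pderiv j g) ∂μ := by
  have key := integral_X_mul_of_jointGaussian h.sumElim (Sum.inl i)
    (rename Sum.inl f * rename Sum.inr g)
  have hl (j : Fin dα) : pderiv (Sum.inl j) (rename (Sum.inr : Fin dβ → Fin dα ⊕ Fin dβ) g) = 0 :=
    pderiv_eq_zero_of_notMem_vars fun hj => by
      classical
      simpa using vars_rename _ _ hj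
  have hr (j : Fin dβ) : pderiv (Sum.inr j) (rename (Sum.inl : Fin dα → Fin dα ⊕ Fin dβ) f) = 0 :=
    pderiv_eq_zero_of_notMem_vars fun hj => by
      classical
      simpa using vars_rename _ _ hj
  simp only [Fintype.sum_sum_type, pderiv_mul, hl, hr, pderiv_rename Sum.inl_injective,
    pderiv_rename Sum.inr_injective, map_mul, eval_rename, Function.comp_def, Sum.elim_inl,
    Sum.elim_inr, mul_zero, zero_mul, add_zero, zero_add, hcov, ite_mul, one_mul,
    Finset.sum_ite_eq, Finset.mem_univ, if_true] at key
  simp only [map_mul, eval_X, mul_assoc]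
  exact key

/-- The number operator turns a covariance of Wick polynomials into one of their gradients. -/
lemma natCast_mul_integral_wickSum_mul (h : IsJointGaussianPair μ Yα Yβ)
    (hcov : ∀ i j, ∫ ω, Yα ω i * Yα ω j ∂μ = if i = j then 1 else 0)
    {n : ℕ} {K : Finset (Fin dα → ℕ)} (hK : ∀ k ∈ K, ∑ i, k i = n) (c : (Fin dα → ℕ) → ℝ)
    (g : MvPolynomial (Fin dβ) ℝ) :
    n * ∫ ω, eval (Yα ω) (wickSum K c) * eval (Yβ ω) g ∂μ
      = ∑ i, ∑ j, (∫ ω, Yα ω i * Yβ ω j ∂μ) *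
          ∫ ω, eval (Yα ω) (pderiv i (wickSum K c)) * eval (Yβ ω) (pderiv j g) ∂μ := by
  have hint := h.integrable_eval_mul_eval
  calc n * ∫ ω, eval (Yα ω) (wickSum K c) * eval (Yβ ω) g ∂μ
      = ∫ ω, eval (Yα ω) ((n : MvPolynomial (Fin dα) ℝ) * wickSum K c) * eval (Yβ ω) g ∂μ := by
        rw [← integral_const_mul]
        simp [mul_assoc]
    _ = ∫ ω, ∑ i, (eval (Yα ω) (MvPolynomial.X i * pderiv i (wickSum K c)) * eval (Yβ ω) g
          - eval (Yα ω) (pderiv i (pderiv i (wickSum K c))) * eval (Yβ ω) g) ∂μ := by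
        rw [← ornsteinUhlenbeck_wickSum hK]
        simp only [map_sum, map_sub, Finset.sum_mul, sub_mul]
    _ = _ := by
        have hi (i) : Integrable (fun ω => eval (Yα ω) (MvPolynomial.X i * pderiv i (wickSum K c))
            * eval (Yβ ω) g - eval (Yα ω) (pderiv i (pderiv i (wickSum K c))) * eval (Yβ ω) g) μ :=
          (hint _ _).sub (hint _ _)
        rw [integral_finsetSum _ fun i _ => hi i]
        refine Finset.sum_congr rfl fun i _ => ?_
        rw [integral_sub (hint _ _) (hint _ _), h.integral_X_mul_eval_mul_eval hcov]
        ring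

/-- The squared norm of the gradient of a degree-`n` Wick polynomial. -/
lemma natCast_mul_integral_wickSum_sq (h : IsJointGaussianPair μ Yα Yβ)
    (hcov : ∀ i j, ∫ ω, Yα ω i * Yα ω j ∂μ = if i = j then 1 else 0)
    {n : ℕ} {K : Finset (Fin dα → ℕ)} (hK : ∀ k ∈ K, ∑ i, k i = n) (c : (Fin dα → ℕ) → ℝ) :
    n * ∫ ω, (eval (Yα ω) (wickSum K c)) ^ 2 ∂μ
      = ∫ ω, ∑ i, (eval (Yα ω) (pderiv i (wickSum K c))) ^ 2 ∂μ := by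
  simp only [sq]
  rw [h.self_left.natCast_mul_integral_wickSum_mul hcov hK,
    integral_finsetSum _ fun i _ => h.self_left.integrable_eval_mul_eval _ _]
  simp [hcov]

end IsJointGaussianPair

/-- If `RᵀR` has no eigenvalue exceeding `s ^ 2`, then `R` has operator norm at most `s`. -/
lemma dotProduct_mulVec_le_of_eigenvalue_le {m n : Type*} [Fintype m] [Fintype n]
    (R : Matrix m n ℝ) (s : ℝ)
    (hsMax : ∀ (t : ℝ) (v : n → ℝ), v ≠ 0 → (R.transpose * R).mulVec v = t • v → t ≤ s ^ 2)
    (v : n → ℝ) : (R *ᵥ v) ⬝ᵥ (R *ᵥ v) ≤ s ^ 2 * (v ⬝ᵥ v) := by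
  classical
  have hR : (Rᵀ * R).IsHermitian := by
    simpa using Matrix.isHermitian_conjTranspose_mul_self R
  have hM : (s ^ 2 • (1 : Matrix n n ℝ) - Rᵀ * R).IsHermitian := by
    refine Matrix.IsHermitian.sub ?_ hR
    simp [Matrix.IsHermitian]
  have hpsd : (s ^ 2 • (1 : Matrix n n ℝ) - Rᵀ * R).PosSemidef := by
    refine hM.posSemidef_iff_eigenvalues_nonneg.2 fun i => ?_
    have hi := hM.mulVec_eigenvectorBasis i
    have hne : (hM.eigenvectorBasis i).ofLp ≠ 0 := fun h0 =>
      hM.eigenvectorBasis.orthonormal.ne_zero i (WithLp.ofLp_injective 2 h0)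
    have := hsMax (s ^ 2 - hM.eigenvalues i) _ hne (by
      rw [sub_smul, ← hi, Matrix.sub_mulVec, Matrix.smul_mulVec, Matrix.one_mulVec]
      abel)
    simpa using this
  have h := hpsd.dotProduct_mulVec_nonneg v
  rw [Matrix.sub_mulVec, Matrix.smul_mulVec, Matrix.one_mulVec, star_trivial, dotProduct_sub,
    dotProduct_smul, ← Matrix.mulVec_mulVec, Matrix.dotProduct_mulVec v Rᵀ,
    Matrix.vecMul_transpose, smul_eq_mul] at h
  linarith

/-- A bilinear form of norm at most `s` satisfies the corresponding weighted Young inequality. -/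
lemma two_mul_dotProduct_mulVec_add_nonneg {m n : Type*} [Fintype m] [Fintype n]
    {R : Matrix m n ℝ} {s : ℝ} (hs : 0 ≤ s)
    (hR : ∀ v, (R *ᵥ v) ⬝ᵥ (R *ᵥ v) ≤ s ^ 2 * (v ⬝ᵥ v)) (t : ℝ) (u : m → ℝ) (v : n → ℝ) :
    0 ≤ s * (u ⬝ᵥ u) * (t * t) + 2 * (u ⬝ᵥ R *ᵥ v) * t + s * (v ⬝ᵥ v) := by
  have hu : 0 ≤ u ⬝ᵥ u := Finset.sum_nonneg fun i _ => mul_self_nonneg _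
  have hv : 0 ≤ v ⬝ᵥ v := Finset.sum_nonneg fun i _ => mul_self_nonneg _
  have hcs : (u ⬝ᵥ R *ᵥ v) ^ 2 ≤ s ^ 2 * ((u ⬝ᵥ u) * (v ⬝ᵥ v)) := by
    have h := Finset.sum_mul_sq_le_sq_mul_sq Finset.univ u (R *ᵥ v)
    simp only [sq (u _), sq ((R *ᵥ v) _)] at h
    calc (u ⬝ᵥ R *ᵥ v) ^ 2 ≤ (u ⬝ᵥ u) * ((R *ᵥ v) ⬝ᵥ (R *ᵥ v)) := h
      _ ≤ (u ⬝ᵥ u) * (s ^ 2 * (v ⬝ᵥ v)) := mul_le_mul_of_nonneg_left (hR v) hu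
      _ = _ := by ring
  have hsq : (2 * (u ⬝ᵥ R *ᵥ v) * t) ^ 2 ≤ (s * (u ⬝ᵥ u) * (t * t) + s * (v ⬝ᵥ v)) ^ 2 := by
    nlinarith [mul_le_mul_of_nonneg_left hcs (sq_nonneg t),
      sq_nonneg (s * (u ⬝ᵥ u) * (t * t) - s * (v ⬝ᵥ v))]
  have := abs_le_of_sq_le_sq' hsq (add_nonneg
    (mul_nonneg (mul_nonneg hs hu) (mul_self_nonneg t)) (mul_nonneg hs hv))
  linarith [this.1]

/-- **Cross-covariance bound for degree-`n` Wick polynomials.** For a jointly Gaussian pair of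
standard Gaussian vectors with cross-correlation matrix `R` of largest singular value `s`,
degree-`n` Wick polynomials `Pₙ(Yα)`, `Pₙ(Yβ)` satisfy
`|E[Pₙ(Yα) Pₙ(Yβ)]| ≤ s ‖Pₙ(Yα)‖₂ ‖Pₙ(Yβ)‖₂`. -/
theorem wick_degree_n_cross_bound
    {Ω : Type*} [MeasurableSpace Ω] (μ : Measure Ω) [IsProbabilityMeasure μ]
    {dα dβ : ℕ} (Yα : Ω → Fin dα → ℝ) (Yβ : Ω → Fin dβ → ℝ)
    (hGauss : IsJointGaussianPair μ Yα Yβ)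
    (hmeanα : ∀ i, ∫ ω, Yα ω i ∂μ = 0)
    (hmeanβ : ∀ j, ∫ ω, Yβ ω j ∂μ = 0)
    (hcovα : ∀ i j, ∫ ω, Yα ω i * Yα ω j ∂μ = if i = j then 1 else 0)
    (hcovβ : ∀ i j, ∫ ω, Yβ ω i * Yβ ω j ∂μ = if i = j then 1 else 0)
    (R : Matrix (Fin dα) (Fin dβ) ℝ)
    (hR : ∀ i j, R i j = ∫ ω, Yα ω i * Yβ ω j ∂μ)
    (s : ℝ) (hs0 : 0 ≤ s)
    (hsEig : ∃ v : Fin dβ → ℝ, v ≠ 0 ∧ (R.transpose * R).mulVec v = s ^ 2 • v)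
    (hsMax : ∀ (t : ℝ) (v : Fin dβ → ℝ), v ≠ 0 → (R.transpose * R).mulVec v = t • v →
      t ≤ s ^ 2)
    (n : ℕ) (hn : 1 ≤ n)
    (K : Finset (Fin dα → ℕ)) (L : Finset (Fin dβ → ℕ))
    (hK : ∀ k ∈ K, ∑ i, k i = n) (hL : ∀ l ∈ L, ∑ j, l j = n)
    (a : (Fin dα → ℕ) → ℝ) (b : (Fin dβ → ℕ) → ℝ)
    (P Q : Ω → ℝ)
    (hP : P = fun ω => ∑ k ∈ K, a k *
      ((∏ i, He (k i) (Yα ω i)) / Real.sqrt (∏ i, (Nat.factorial (k i) : ℝ))))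
    (hQ : Q = fun ω => ∑ l ∈ L, b l *
      ((∏ j, He (l j) (Yβ ω j)) / Real.sqrt (∏ j, (Nat.factorial (l j) : ℝ)))) :
    |∫ ω, P ω * Q ω ∂μ| ≤
      s * Real.sqrt (∫ ω, (P ω) ^ 2 ∂μ) * Real.sqrt (∫ ω, (Q ω) ^ 2 ∂μ) := by
  obtain ⟨A, hA⟩ : ∃ A : MvPolynomial (Fin dα) ℝ, A = wickSum K fun k =>
    a k / Real.sqrt (∏ i, (Nat.factorial (k i) : ℝ)) := ⟨_, rfl⟩
  obtain ⟨B, hB⟩ : ∃ B : MvPolynomial (Fin dβ) ℝ, B = wickSum L fun l =>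
    b l / Real.sqrt (∏ j, (Nat.factorial (l j) : ℝ)) := ⟨_, rfl⟩
  have hPA : P = fun ω => eval (Yα ω) A := by
    funext ω
    simp only [hP, hA, wickSum, map_sum, map_mul, eval_C, eval_wickPoly]
    exact Finset.sum_congr rfl fun k _ => by ring
  have hQB : Q = fun ω => eval (Yβ ω) B := by
    funext ω
    simp only [hQ, hB, wickSum, map_sum, map_mul, eval_C, eval_wickPoly]
    exact Finset.sum_congr rfl fun l _ => by ring
  have hn0 : (0 : ℝ) < n := by exact_mod_cast hn
  have hintA := hGauss.self_left.integrable_eval_mul_eval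
  have hintB := hGauss.self_right.integrable_eval_mul_eval
  have hint := hGauss.integrable_eval_mul_eval
  set u : Ω → Fin dα → ℝ := fun ω i => eval (Yα ω) (pderiv i A) with hu
  set v : Ω → Fin dβ → ℝ := fun ω j => eval (Yβ ω) (pderiv j B) with hv
  have hAA : ∫ ω, u ω ⬝ᵥ u ω ∂μ = n * ∫ ω, (P ω) ^ 2 ∂μ := by
    have h : (n : ℝ) * ∫ ω, (eval (Yα ω) A) ^ 2 ∂μ
        = ∫ ω, ∑ i, (eval (Yα ω) (pderiv i A)) ^ 2 ∂μ := by
      rw [hA]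
      exact hGauss.natCast_mul_integral_wickSum_sq hcovα hK _
    rw [hPA, h]
    simp only [hu, dotProduct, sq]
  have hBB : ∫ ω, v ω ⬝ᵥ v ω ∂μ = n * ∫ ω, (Q ω) ^ 2 ∂μ := by
    have h : (n : ℝ) * ∫ ω, (eval (Yβ ω) B) ^ 2 ∂μ
        = ∫ ω, ∑ j, (eval (Yβ ω) (pderiv j B)) ^ 2 ∂μ := by
      rw [hB]
      exact hGauss.self_right.natCast_mul_integral_wickSum_sq hcovβ hL _
    rw [hQB, h]
    simp only [hv, dotProduct, sq]
  have hbil (ω : Ω) : u ω ⬝ᵥ R *ᵥ v ω = ∑ i, ∑ j, R i j * (u ω i * v ω j) := by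
    simp only [dotProduct, mulVec, Finset.mul_sum]
    exact Finset.sum_congr rfl fun i _ => Finset.sum_congr rfl fun j _ => by ring
  have hR_int (i j) : Integrable (fun ω => R i j * (u ω i * v ω j)) μ := (hint _ _).const_mul _
  have hAB : ∫ ω, u ω ⬝ᵥ R *ᵥ v ω ∂μ = n * ∫ ω, P ω * Q ω ∂μ := by
    simp only [hPA, hQB]
    rw [hA, hGauss.natCast_mul_integral_wickSum_mul hcovα hK, ← hA]
    simp only [hbil]
    rw [integral_finsetSum _ fun i _ => integrable_finsetSum _ fun j _ => hR_int i j]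
    refine Finset.sum_congr rfl fun i _ => ?_
    rw [integral_finsetSum _ fun j _ => hR_int i j]
    exact Finset.sum_congr rfl fun j _ => by rw [integral_const_mul, hR]
  have hiu : Integrable (fun ω => u ω ⬝ᵥ u ω) μ := integrable_finsetSum _ fun i _ => hintA _ _
  have hiv : Integrable (fun ω => v ω ⬝ᵥ v ω) μ := integrable_finsetSum _ fun j _ => hintB _ _
  have hiuv : Integrable (fun ω => u ω ⬝ᵥ R *ᵥ v ω) μ := by
    simp only [hbil]
    exact integrable_finsetSum _ fun i _ => integrable_finsetSum _ fun j _ => hR_int i j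
  have hquad (t : ℝ) : 0 ≤ s * (∫ ω, (P ω) ^ 2 ∂μ) * (t * t) + 2 * (∫ ω, P ω * Q ω ∂μ) * t
      + s * ∫ ω, (Q ω) ^ 2 ∂μ := by
    have h : 0 ≤ ∫ ω, (s * (u ω ⬝ᵥ u ω) * (t * t) + 2 * (u ω ⬝ᵥ R *ᵥ v ω) * t
        + s * (v ω ⬝ᵥ v ω)) ∂μ := integral_nonneg fun ω => two_mul_dotProduct_mulVec_add_nonneg hs0
      (dotProduct_mulVec_le_of_eigenvalue_le R s hsMax) t (u ω) (v ω)
    have h' : Integrable (fun ω => s * (u ω ⬝ᵥ u ω) * (t * t) + 2 * (u ω ⬝ᵥ R *ᵥ v ω) * t) μ :=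
      ((hiu.const_mul s).mul_const _).add ((hiuv.const_mul 2).mul_const t)
    rw [integral_add h' (hiv.const_mul s), integral_add ((hiu.const_mul s).mul_const _)
      ((hiuv.const_mul 2).mul_const t), integral_mul_const, integral_mul_const,
      integral_const_mul, integral_const_mul, integral_const_mul, hAA, hBB, hAB] at h
    refine nonneg_of_mul_nonneg_right (a := (n : ℝ)) ?_ hn0
    linarith
  have hdisc := discrim_le_zero hquad
  rw [discrim] at hdisc
  have hP0 : 0 ≤ ∫ ω, (P ω) ^ 2 ∂μ := integral_nonneg fun ω => sq_nonneg _
  have hQ0 : 0 ≤ ∫ ω, (Q ω) ^ 2 ∂μ := integral_nonneg fun ω => sq_nonneg _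
  refine abs_le_of_sq_le_sq ?_ (by positivity)
  rw [mul_pow, mul_pow, Real.sq_sqrt hP0, Real.sq_sqrt hQ0]
  linarith
end

section
/- Let (Ȳ_α, Ȳ_β) be a jointly Gaussian pair of random vectors, each standard Gaussian, of dimensions d_α and d_β, with cross-correlation matrix R = (E[Y_{α,i} Y_{β,j}])_{i,j}, and let s* be the largest singular value of R. Then for all measurable φ : R^{d_α} → R and ψ : R^{d_β} → R with E[φ(Ȳ_α)] = E[ψ(Ȳ_β)] = 0 and φ(Ȳ_α), ψ(Ȳ_β) square-integrable, one has |E[φ(Ȳ_α) · ψ(Ȳ_β)]| ≤ s* · ‖φ(Ȳ_α)‖_2 · ‖ψ(Ȳ_β)‖_2. -/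
open MeasureTheory ProbabilityTheory
open scoped NNReal

open Matrix
open scoped ENNReal InnerProductSpace

/-- The entrywise sum of a series of positive semidefinite matrices is positive semidefinite. -/
lemma Matrix.PosSemidef.of_hasSum {ι : Type*} {A : ℕ → Matrix ι ι ℝ} {M : Matrix ι ι ℝ}
    (hA : ∀ n, (A n).PosSemidef) (hM : ∀ i j, HasSum (fun n => A n i j) (M i j)) :
    M.PosSemidef := by
  refine ⟨?_, fun x => ?_⟩
  · ext i j
    refine (hM j i).unique ?_
    simpa only [← (hA _).1.apply j i, star_trivial] using hM i j
  · refine HasSum.nonneg (L := .unconditional ℕ) (fun n => (hA n).2 x) ?_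
    exact hasSum_sum fun i _ => hasSum_sum fun j _ => ((hM i j).mul_left _).mul_right _

/-- Entrywise powers of a positive semidefinite matrix are positive semidefinite. -/
lemma Matrix.PosSemidef.entrywise_pow_succ {ι : Type*} {A : Matrix ι ι ℝ} (hA : A.PosSemidef)
    (n : ℕ) : (Matrix.of fun i j => A i j ^ (n + 1)).PosSemidef := by
  induction n with
  | zero => simp only [zero_add, pow_one]; exact hA
  | succ n ih =>
    have h : (Matrix.of fun i j => A i j ^ (n + 1 + 1)) =
        (Matrix.of fun i j => A i j ^ (n + 1)) ⊙ A := by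
      ext i j
      simp [pow_succ]
    rw [h]
    exact ih.hadamard hA

/-- The Gram matrix of a family of vectors for a positive semidefinite form. -/
lemma Matrix.PosSemidef.gram_form {ι n : Type*} [Fintype n] {N : Matrix n n ℝ}
    (hN : N.PosSemidef) (u : ι → n → ℝ) :
    (Matrix.of fun i j => u i ⬝ᵥ N *ᵥ u j).PosSemidef := by
  refine ⟨?_, fun x => ?_⟩
  · ext i j
    have : Nᵀ = N := hN.1
    simp only [conjTranspose_apply, of_apply, star_trivial]
    rw [dotProduct_mulVec, ← mulVec_transpose, this, dotProduct_comm]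
  · have h := hN.dotProduct_mulVec_nonneg (∑ i ∈ x.support, x i • u i)
    simp only [mulVec_sum, sum_dotProduct, dotProduct_sum, mulVec_smul, smul_dotProduct,
      dotProduct_smul, star_trivial, smul_eq_mul, Finset.mul_sum] at h
    rw [Finset.sum_comm] at h
    refine h.trans_eq (Finset.sum_congr rfl fun i _ => Finset.sum_congr rfl fun j _ => ?_)
    simp only [star_trivial, of_apply]
    ring

lemma hasSum_exp_sub_one (t : ℝ) :
    HasSum (fun n : ℕ => t ^ (n + 1) / (n + 1).factorial) (Real.exp t - 1) := by
  have h := NormedSpace.expSeries_div_hasSum_exp (𝔸 := ℝ) t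
  rw [← Real.exp_eq_exp_ℝ] at h
  simpa using (hasSum_nat_add_iff' 1).mpr h

section Kernel

variable {m n : Type*} [Fintype m] [Fintype n]

/-- The covariance kernel of normalized exponentials of two correlated Gaussian vectors, with its
diagonal blocks multiplied by a bound `s` on the correlation, is positive semidefinite. -/
lemma posSemidef_exp_kernel [DecidableEq m] [DecidableEq n] {R : Matrix m n ℝ} {s : ℝ}
    (hs0 : 0 ≤ s) (hs1 : s ≤ 1)
    (hR : (fromBlocks (s • 1) R Rᵀ (s • 1)).PosSemidef) :
    (fromBlocks (Matrix.of fun a a' : m → ℝ => s * (Real.exp (a ⬝ᵥ a') - 1))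
      (Matrix.of fun (a : m → ℝ) (b : n → ℝ) => Real.exp (a ⬝ᵥ R *ᵥ b) - 1)
      (Matrix.of fun (b : n → ℝ) (a : m → ℝ) => Real.exp (a ⬝ᵥ R *ᵥ b) - 1)
      (Matrix.of fun b b' : n → ℝ => s * (Real.exp (b ⬝ᵥ b') - 1))).PosSemidef := by
  set u : (m → ℝ) ⊕ (n → ℝ) → m ⊕ n → ℝ :=
    Sum.elim (fun a => Sum.elim a 0) (fun b => Sum.elim 0 b) with hu
  have hG := hR.gram_form u
  have hH := (PosSemidef.one (n := m ⊕ n) (R := ℝ)).gram_form u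
  refine PosSemidef.of_hasSum (A := fun k => ((k + 1).factorial : ℝ)⁻¹ •
    ((Matrix.of fun i j => (u i ⬝ᵥ fromBlocks (s • 1) R Rᵀ (s • 1) *ᵥ u j) ^ (k + 1)) +
      (s - s ^ (k + 1)) • Matrix.of fun i j => (u i ⬝ᵥ (1 : Matrix _ _ ℝ) *ᵥ u j) ^ (k + 1)))
    (fun k => ?_) ?_
  · refine PosSemidef.smul (.add (hG.entrywise_pow_succ k) (.smul (hH.entrywise_pow_succ k) ?_))
      (by positivity)
    exact sub_nonneg.2 (pow_le_of_le_one hs0 hs1 (by simp))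
  · rintro (a | b) (a' | b')
    · refine ((hasSum_exp_sub_one (a ⬝ᵥ a')).mul_left s).congr_fun fun k => ?_
      simp [hu, fromBlocks_mulVec, smul_mulVec, mul_pow]
      ring
    · refine (hasSum_exp_sub_one (a ⬝ᵥ R *ᵥ b')).congr_fun fun k => ?_
      simp [hu, fromBlocks_mulVec]
      ring
    · refine (hasSum_exp_sub_one (a' ⬝ᵥ R *ᵥ b)).congr_fun fun k => ?_
      have : b ⬝ᵥ Rᵀ *ᵥ a' = a' ⬝ᵥ R *ᵥ b := by
        rw [mulVec_transpose, dotProduct_comm, dotProduct_mulVec]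
      simp [hu, fromBlocks_mulVec, this]
      ring
    · refine ((hasSum_exp_sub_one (b ⬝ᵥ b')).mul_left s).congr_fun fun k => ?_
      simp [hu, fromBlocks_mulVec, smul_mulVec, mul_pow]
      ring

/-- A bound on the eigenvalues of `Rᵀ R` bounds the quadratic form `|R b|²`. -/
lemma mulVec_dotProduct_mulVec_le {R : Matrix m n ℝ} {c : ℝ}
    (h : ∀ (t : ℝ) (v : n → ℝ), v ≠ 0 → (Rᵀ * R) *ᵥ v = t • v → t ≤ c) (b : n → ℝ) :
    R *ᵥ b ⬝ᵥ R *ᵥ b ≤ c * (b ⬝ᵥ b) := by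
  classical
  have hA : (c • 1 - Rᵀ * R).IsHermitian := by
    simp [IsHermitian, conjTranspose_eq_transpose_of_trivial]
  have hpsd : (c • 1 - Rᵀ * R).PosSemidef := by
    rw [hA.posSemidef_iff_eigenvalues_nonneg]
    intro i
    have hv := hA.mulVec_eigenvectorBasis i
    have hne : (hA.eigenvectorBasis i).ofLp ≠ 0 := fun h0 =>
      hA.eigenvectorBasis.orthonormal.ne_zero i (by ext j; simp [h0])
    have := h (c - hA.eigenvalues i) _ hne (by
      rw [sub_smul, ← hv, sub_mulVec, smul_mulVec, one_mulVec]; simp)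
    simp only [Pi.zero_apply]
    linarith
  have := hpsd.dotProduct_mulVec_nonneg b
  rw [sub_mulVec, smul_mulVec, one_mulVec, dotProduct_sub, ← mulVec_mulVec, mulVec_transpose,
    star_trivial, dotProduct_smul, dotProduct_comm b (_ ᵥ* _), ← dotProduct_mulVec, smul_eq_mul]
    at this
  linarith

lemma posSemidef_fromBlocks_smul_one [DecidableEq m] [DecidableEq n] {R : Matrix m n ℝ} {s : ℝ}
    (hs0 : 0 ≤ s) (h : ∀ b : n → ℝ, R *ᵥ b ⬝ᵥ R *ᵥ b ≤ s ^ 2 * (b ⬝ᵥ b)) :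
    (fromBlocks (s • 1) R Rᵀ (s • 1)).PosSemidef := by
  refine .of_dotProduct_mulVec_nonneg ?_ fun x => ?_
  · simp [IsHermitian, conjTranspose_eq_transpose_of_trivial, fromBlocks_transpose]
  obtain ⟨a, b, rfl⟩ : ∃ a b, x = Sum.elim a b := ⟨x ∘ Sum.inl, x ∘ Sum.inr, by simp⟩
  have ht : b ⬝ᵥ Rᵀ *ᵥ a = a ⬝ᵥ R *ᵥ b := by
    rw [mulVec_transpose, dotProduct_comm, dotProduct_mulVec]
  have ha : 0 ≤ a ⬝ᵥ a := by simpa using dotProduct_star_self_nonneg a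
  have hb : 0 ≤ b ⬝ᵥ b := by simpa using dotProduct_star_self_nonneg b
  have hcs : (a ⬝ᵥ R *ᵥ b) ^ 2 ≤ (a ⬝ᵥ a) * (R *ᵥ b ⬝ᵥ R *ᵥ b) := by
    simpa [dotProduct, pow_two] using Finset.sum_mul_sq_le_sq_mul_sq Finset.univ a (R *ᵥ b)
  have hle : (a ⬝ᵥ R *ᵥ b) ^ 2 ≤ (s * (a ⬝ᵥ a + b ⬝ᵥ b) / 2) ^ 2 := by
    have := mul_le_mul_of_nonneg_left (h b) ha
    nlinarith [mul_nonneg (sq_nonneg s) (sq_nonneg (a ⬝ᵥ a - b ⬝ᵥ b))]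
  have := (abs_le_of_sq_le_sq' hle (by positivity)).1
  simp [fromBlocks_mulVec, smul_mulVec, ht]
  linarith

end Kernel

section Hilbert

variable {H : Type*} [NormedAddCommGroup H] [InnerProductSpace ℝ H]

lemma inner_sum_sub_inner_mul_inner_sum {ι κ : Type*} (u : H) (e : ι → H) (e' : κ → H)
    (x : ι →₀ ℝ) (y : κ →₀ ℝ) :
    ⟪x.sum fun i a => a • e i, y.sum fun j b => b • e' j⟫_ℝ -
      ⟪u, x.sum fun i a => a • e i⟫_ℝ * ⟪u, y.sum fun j b => b • e' j⟫_ℝ =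
    ∑ i ∈ x.support, ∑ j ∈ y.support,
      x i * (⟪e i, e' j⟫_ℝ - ⟪u, e i⟫_ℝ * ⟪u, e' j⟫_ℝ) * y j := by
  simp only [Finsupp.sum, sum_inner, inner_sum, real_inner_smul_left, real_inner_smul_right,
    Finset.sum_mul_sum]
  rw [Finset.sum_comm (s := y.support)]
  simp only [← Finset.sum_sub_distrib]
  exact Finset.sum_congr rfl fun i _ => Finset.sum_congr rfl fun j _ => by ring

/-- If a kernel dominating the covariances `⟪h, k⟫ - ⟪u, h⟫ ⟪u, k⟫` of two families is positive
semidefinite, the corresponding correlation bound holds on the closed spans of the families. -/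
lemma sq_cov_le_of_posSemidef {ι κ : Type*} (u : H) (e : ι → H) (e' : κ → H) (s : ℝ)
    (hK : (fromBlocks (Matrix.of fun i j => s * (⟪e i, e j⟫_ℝ - ⟪u, e i⟫_ℝ * ⟪u, e j⟫_ℝ))
      (Matrix.of fun i j => ⟪e i, e' j⟫_ℝ - ⟪u, e i⟫_ℝ * ⟪u, e' j⟫_ℝ)
      (Matrix.of fun j i => ⟪e i, e' j⟫_ℝ - ⟪u, e i⟫_ℝ * ⟪u, e' j⟫_ℝ)
      (Matrix.of fun i j => s * (⟪e' i, e' j⟫_ℝ - ⟪u, e' i⟫_ℝ * ⟪u, e' j⟫_ℝ))).PosSemidef)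
    {h k : H} (hh : h ∈ (Submodule.span ℝ (Set.range e)).topologicalClosure)
    (hk : k ∈ (Submodule.span ℝ (Set.range e')).topologicalClosure) :
    (⟪h, k⟫_ℝ - ⟪u, h⟫_ℝ * ⟪u, k⟫_ℝ) ^ 2 ≤
      s ^ 2 * (⟪h, h⟫_ℝ - ⟪u, h⟫_ℝ ^ 2) * (⟪k, k⟫_ℝ - ⟪u, k⟫_ℝ ^ 2) := by
  have key : ∀ h ∈ (Submodule.span ℝ (Set.range e)).topologicalClosure,
      ∀ k ∈ (Submodule.span ℝ (Set.range e')).topologicalClosure,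
      0 ≤ s * (⟪h, h⟫_ℝ - ⟪u, h⟫_ℝ ^ 2) + s * (⟪k, k⟫_ℝ - ⟪u, k⟫_ℝ ^ 2) +
        2 * (⟪h, k⟫_ℝ - ⟪u, h⟫_ℝ * ⟪u, k⟫_ℝ) := by
    intro h hh k hk
    have hcl : IsClosed {p : H × H | 0 ≤ s * (⟪p.1, p.1⟫_ℝ - ⟪u, p.1⟫_ℝ ^ 2) +
        s * (⟪p.2, p.2⟫_ℝ - ⟪u, p.2⟫_ℝ ^ 2) +
        2 * (⟪p.1, p.2⟫_ℝ - ⟪u, p.1⟫_ℝ * ⟪u, p.2⟫_ℝ)} :=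
      isClosed_le continuous_const (by fun_prop)
    have hmem : (h, k) ∈ closure ((Submodule.span ℝ (Set.range e) : Set H) ×ˢ
        (Submodule.span ℝ (Set.range e') : Set H)) := by
      rw [closure_prod_eq]; exact ⟨hh, hk⟩
    refine closure_minimal ?_ hcl hmem
    rintro ⟨f, g⟩ ⟨hf, hg⟩
    obtain ⟨x, rfl⟩ := (Finsupp.mem_span_range_iff_exists_finsupp).1 hf
    obtain ⟨y, rfl⟩ := (Finsupp.mem_span_range_iff_exists_finsupp).1 hg
    have := hK.2 (Finsupp.sumElim x y)
    simp only [Finsupp.sum_sumElim, Function.comp_def, fromBlocks_apply₁₁, fromBlocks_apply₁₂,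
      fromBlocks_apply₂₁, fromBlocks_apply₂₂, of_apply, star_trivial] at this
    simp only [Finsupp.sum, Finset.sum_add_distrib] at this
    rw [Finset.sum_comm (s := y.support) (t := x.support)] at this
    simp only [Set.mem_ofPred_eq, pow_two, two_mul, inner_sum_sub_inner_mul_inner_sum,
      Finset.mul_sum]
    simp only [mul_comm, mul_left_comm, mul_assoc] at this ⊢
    linarith
  have hd := discrim_le_zero (a := s * (⟪h, h⟫_ℝ - ⟪u, h⟫_ℝ ^ 2))
    (b := 2 * (⟪h, k⟫_ℝ - ⟪u, h⟫_ℝ * ⟪u, k⟫_ℝ)) (c := s * (⟪k, k⟫_ℝ - ⟪u, k⟫_ℝ ^ 2)) fun x => by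
      have := key (x • h) (Submodule.smul_mem _ _ hh) k hk
      simp only [real_inner_smul_left, real_inner_smul_right] at this
      linarith
  rw [discrim] at hd
  linarith

lemma LinearIsometry.map_mem_topologicalClosure_span {F ι : Type*} [NormedAddCommGroup F]
    [InnerProductSpace ℝ F] (J : F →ₗᵢ[ℝ] H) {e : ι → F}
    (he : (Submodule.span ℝ (Set.range e)).topologicalClosure = ⊤) {e' : ι → H}
    (h : ∀ i, J (e i) = e' i) (f : F) :
    J f ∈ (Submodule.span ℝ (Set.range e')).topologicalClosure := by
  have hf : f ∈ closure (Submodule.span ℝ (Set.range e) : Set F) := by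
    rw [← Submodule.topologicalClosure_coe, he]
    trivial
  refine map_mem_closure J.continuous hf fun g hg => ?_
  have := Submodule.mem_map_of_mem (f := J.toLinearMap) hg
  rw [Submodule.map_span, ← Set.range_comp] at this
  rwa [show J.toLinearMap ∘ e = e' from funext h] at this

end Hilbert

section Exponentials

variable {m : Type*} [Fintype m]

/-- A finite measure with finite exponential moments is determined by its Laplace transform. -/
lemma ext_of_integral_exp_dotProduct {ρ ρ' : Measure (m → ℝ)} [IsFiniteMeasure ρ]
    [IsFiniteMeasure ρ'] (hint : ∀ a : m → ℝ, Integrable (fun x => Real.exp (a ⬝ᵥ x)) ρ)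
    (h : ∀ a : m → ℝ, ∫ x, Real.exp (a ⬝ᵥ x) ∂ρ = ∫ x, Real.exp (a ⬝ᵥ x) ∂ρ') : ρ = ρ' := by
  classical
  refine Measure.ext_of_charFunDual (funext fun L => ?_)
  set a : m → ℝ := fun i => L (Pi.single i 1) with ha
  have hL : ∀ (t : ℝ) (x : m → ℝ), t * L x = (t • a) ⬝ᵥ x := by
    intro t x
    conv_lhs => rw [pi_eq_sum_univ' x]
    simp [ha, dotProduct, Finset.mul_sum, mul_comm, mul_left_comm]
  have hmgf : mgf L ρ = mgf L ρ' := by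
    ext t
    simpa only [mgf, hL] using h (t • a)
  have hset : integrableExpSet L ρ = Set.univ := by
    ext t
    simpa only [integrableExpSet, Set.mem_ofPred_eq, hL, Set.mem_univ, iff_true]
      using hint (t • a)
  have hzero : ρ = 0 ↔ ρ' = 0 := by
    have := congrFun hmgf 0
    simp only [mgf_zero'] at this
    rw [← Measure.measure_univ_eq_zero, ← measureReal_eq_zero_iff, this, measureReal_eq_zero_iff,
      Measure.measure_univ_eq_zero]
  have := eqOn_complexMGF_of_mgf' hmgf hzero (x := Complex.I) (by simp [hset])
  simpa only [complexMGF, charFunDual_apply, mul_comm] using this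

/-- Exponentials of linear forms span a dense subspace of `L²` of a finite measure. -/
lemma topologicalClosure_span_exp_eq_top {ν : Measure (m → ℝ)} [IsFiniteMeasure ν]
    (c : (m → ℝ) → ℝ) (e : (m → ℝ) → Lp ℝ 2 ν)
    (he : ∀ a, e a =ᵐ[ν] fun x => Real.exp (a ⬝ᵥ x - c a)) :
    (Submodule.span ℝ (Set.range e)).topologicalClosure = ⊤ := by
  rw [Submodule.topologicalClosure_eq_top_iff, Submodule.eq_bot_iff]
  intro f hf
  have hfm : Measurable f := (Lp.stronglyMeasurable f).measurable
  have hfn : Measurable fun x => -f x := hfm.neg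
  have hfi : Integrable f ν := (Lp.memLp f).integrable (by norm_num)
  have hprod : ∀ a, (fun x => f x * Real.exp (a ⬝ᵥ x)) =ᵐ[ν]
      fun x => Real.exp (c a) * ⟪e a x, f x⟫_ℝ := by
    intro a
    filter_upwards [he a] with x hx
    simp only [hx, Real.exp_sub, RCLike.inner_apply, conj_trivial]
    field_simp
  have hint : ∀ a, Integrable (fun x => f x * Real.exp (a ⬝ᵥ x)) ν := fun a =>
    ((L2.integrable_inner (𝕜 := ℝ) (e a) f).const_mul _).congr (hprod a).symm
  have hzero : ∀ a, ∫ x, f x * Real.exp (a ⬝ᵥ x) ∂ν = 0 := by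
    intro a
    rw [integral_congr_ae (hprod a), integral_const_mul, ← L2.inner_def,
      (Submodule.mem_orthogonal _ f).1 hf _ (Submodule.subset_span ⟨a, rfl⟩), mul_zero]
  have hintp : ∀ a, Integrable (fun x => max (f x) 0 * Real.exp (a ⬝ᵥ x)) ν := by
    intro a
    refine (hint a).pos_part.congr (.of_forall fun x => ?_)
    simp [max_mul_of_nonneg _ _ (Real.exp_pos (a ⬝ᵥ x)).le]
  have hintn : ∀ a, Integrable (fun x => max (-f x) 0 * Real.exp (a ⬝ᵥ x)) ν := by
    intro a
    refine (hint a).neg_part.congr (.of_forall fun x => ?_)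
    simp [max_mul_of_nonneg _ _ (Real.exp_pos (a ⬝ᵥ x)).le]
  have := isFiniteMeasure_withDensity_ofReal hfi.2
  have : IsFiniteMeasure (ν.withDensity fun x => ENNReal.ofReal (-f x)) :=
    isFiniteMeasure_withDensity_ofReal hfi.neg.2
  have hmeas : ν.withDensity (fun x => ENNReal.ofReal (f x)) =
      ν.withDensity (fun x => ENNReal.ofReal (-f x)) := by
    refine ext_of_integral_exp_dotProduct (fun a => ?_) fun a => ?_
    · rw [integrable_withDensity_iff_integrable_smul' hfm.ennreal_ofReal (by simp)]
      simpa [ENNReal.toReal_ofReal'] using hintp a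
    · rw [integral_withDensity_eq_integral_toReal_smul hfm.ennreal_ofReal (by simp),
        integral_withDensity_eq_integral_toReal_smul hfn.ennreal_ofReal (by simp),
        ← sub_eq_zero]
      simp only [ENNReal.toReal_ofReal', smul_eq_mul]
      rw [← integral_sub (hintp a) (hintn a)]
      refine Eq.trans ?_ (hzero a)
      congr with x
      rw [← sub_mul, max_zero_sub_max_neg_zero_eq_self]
  rw [withDensity_eq_iff_of_sigmaFinite hfm.ennreal_ofReal.aemeasurable
    hfn.ennreal_ofReal.aemeasurable] at hmeas
  rw [Lp.eq_zero_iff_ae_eq_zero]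
  filter_upwards [hmeas] with x hx
  have := congrArg ENNReal.toReal hx
  simp only [ENNReal.toReal_ofReal'] at this
  have hsub := max_zero_sub_max_neg_zero_eq_self (f x)
  rw [this, sub_self] at hsub
  exact hsub.symm

end Exponentials

section Joint

variable {m n : Type*} [Fintype m] [Fintype n]

/-- The correlation bound, for a law on a product space with the Laplace transform of a pair of
standard Gaussian vectors with cross-correlation matrix `R`. -/
lemma sq_integral_mul_le_of_laplace [DecidableEq m] [DecidableEq n]
    {P : Measure ((m → ℝ) × (n → ℝ))} [IsProbabilityMeasure P] {R : Matrix m n ℝ} {s : ℝ}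
    (hs0 : 0 ≤ s) (hs1 : s ≤ 1) (hR : (fromBlocks (s • 1) R Rᵀ (s • 1)).PosSemidef)
    (hint : ∀ a b, Integrable (fun z => Real.exp (a ⬝ᵥ z.1 + b ⬝ᵥ z.2)) P)
    (hval : ∀ a b, ∫ z, Real.exp (a ⬝ᵥ z.1 + b ⬝ᵥ z.2) ∂P =
      Real.exp ((a ⬝ᵥ a + b ⬝ᵥ b) / 2 + a ⬝ᵥ R *ᵥ b))
    {φ : (m → ℝ) → ℝ} {ψ : (n → ℝ) → ℝ} (hφ : Measurable φ) (hψ : Measurable ψ)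
    (hφ0 : ∫ z, φ z.1 ∂P = 0) (hψ0 : ∫ z, ψ z.2 ∂P = 0)
    (hφ2 : Integrable (fun z => φ z.1 ^ 2) P) (hψ2 : Integrable (fun z => ψ z.2 ^ 2) P) :
    (∫ z, φ z.1 * ψ z.2 ∂P) ^ 2 ≤ s ^ 2 * (∫ z, φ z.1 ^ 2 ∂P) * ∫ z, ψ z.2 ^ 2 ∂P := by
  have hE : ∀ (a : m → ℝ) (b : n → ℝ), MemLp (fun z : (m → ℝ) × (n → ℝ) =>
      Real.exp (a ⬝ᵥ z.1 + b ⬝ᵥ z.2 - (a ⬝ᵥ a + b ⬝ᵥ b) / 2)) 2 P := by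
    intro a b
    rw [memLp_two_iff_integrable_sq (by fun_prop)]
    refine ((hint (a + a) (b + b)).mul_const (Real.exp (-(a ⬝ᵥ a + b ⬝ᵥ b)))).congr
      (.of_forall fun z => ?_)
    simp only [pow_two, ← Real.exp_add, add_dotProduct]
    ring_nf
  set E : (m → ℝ) → (n → ℝ) → Lp ℝ 2 P := fun a b => (hE a b).toLp _ with hEdef
  have hinner : ∀ a b a' b', ⟪E a b, E a' b'⟫_ℝ = Real.exp (a ⬝ᵥ a' + b ⬝ᵥ b' +
      (a ⬝ᵥ R *ᵥ b + a ⬝ᵥ R *ᵥ b' + a' ⬝ᵥ R *ᵥ b + a' ⬝ᵥ R *ᵥ b')) := by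
    intro a b a' b'
    rw [L2.inner_def]
    have : (fun z => ⟪E a b z, E a' b' z⟫_ℝ) =ᵐ[P] fun z =>
        Real.exp ((a + a') ⬝ᵥ z.1 + (b + b') ⬝ᵥ z.2) *
          Real.exp (-(a ⬝ᵥ a + b ⬝ᵥ b + a' ⬝ᵥ a' + b' ⬝ᵥ b') / 2) := by
      filter_upwards [(hE a b).coeFn_toLp, (hE a' b').coeFn_toLp] with z h1 h2
      simp only [hEdef, h1, h2, RCLike.inner_apply, conj_trivial, ← Real.exp_add, add_dotProduct]
      ring_nf
    rw [integral_congr_ae this, integral_mul_const, hval, ← Real.exp_add]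
    simp only [add_dotProduct, dotProduct_add, mulVec_add, dotProduct_comm a' a,
      dotProduct_comm b' b]
    ring_nf
  have hfst : MeasurePreserving Prod.fst P (P.map Prod.fst) := measurable_fst.measurePreserving P
  have hsnd : MeasurePreserving Prod.snd P (P.map Prod.snd) := measurable_snd.measurePreserving P
  have hEα : ∀ a : m → ℝ, MemLp (fun x => Real.exp (a ⬝ᵥ x - a ⬝ᵥ a / 2)) 2 (P.map Prod.fst) := by
    intro a
    rw [memLp_map_measure_iff (by fun_prop) (by fun_prop)]
    simpa [Function.comp_def] using hE a 0
  have hEβ : ∀ b : n → ℝ, MemLp (fun x => Real.exp (b ⬝ᵥ x - b ⬝ᵥ b / 2)) 2 (P.map Prod.snd) := by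
    intro b
    rw [memLp_map_measure_iff (by fun_prop) (by fun_prop)]
    simpa [Function.comp_def] using hE 0 b
  have hdα := topologicalClosure_span_exp_eq_top _ _ fun a => (hEα a).coeFn_toLp
  have hdβ := topologicalClosure_span_exp_eq_top _ _ fun b => (hEβ b).coeFn_toLp
  have hφL : MemLp φ 2 (P.map Prod.fst) := by
    rw [memLp_map_measure_iff (by fun_prop) (by fun_prop)]
    exact (memLp_two_iff_integrable_sq (hφ.comp measurable_fst).aestronglyMeasurable).2 hφ2
  have hψL : MemLp ψ 2 (P.map Prod.snd) := by
    rw [memLp_map_measure_iff (by fun_prop) (by fun_prop)]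
    exact (memLp_two_iff_integrable_sq (hψ.comp measurable_snd).aestronglyMeasurable).2 hψ2
  set h : Lp ℝ 2 P := (hφL.comp_measurePreserving hfst).toLp _ with hh
  set k : Lp ℝ 2 P := (hψL.comp_measurePreserving hsnd).toLp _ with hk
  have hmemα : h ∈ (Submodule.span ℝ (Set.range fun a => E a 0)).topologicalClosure :=
    (Lp.compMeasurePreservingₗᵢ ℝ Prod.fst hfst).map_mem_topologicalClosure_span hdα
      (fun a => (Lp.toLp_compMeasurePreserving (hEα a) hfst).trans <| by
        simp [hEdef, Function.comp_def]) (hφL.toLp φ)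
  have hmemβ : k ∈ (Submodule.span ℝ (Set.range fun b => E 0 b)).topologicalClosure :=
    (Lp.compMeasurePreservingₗᵢ ℝ Prod.snd hsnd).map_mem_topologicalClosure_span hdβ
      (fun b => (Lp.toLp_compMeasurePreserving (hEβ b) hsnd).trans <| by
        simp [hEdef, Function.comp_def]) (hψL.toLp ψ)
  have hcov := sq_cov_le_of_posSemidef (E 0 0) (fun a => E a 0) (fun b => E 0 b) s
    (by simpa [hinner] using posSemidef_exp_kernel hs0 hs1 hR) hmemα hmemβ
  have hφc := (hφL.comp_measurePreserving hfst).coeFn_toLp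
  have hψc := (hψL.comp_measurePreserving hsnd).coeFn_toLp
  have huh : ⟪E 0 0, h⟫_ℝ = 0 := by
    rw [L2.inner_def, ← hφ0]
    refine integral_congr_ae ?_
    filter_upwards [(hE 0 0).coeFn_toLp, hφc] with z _ h2
    simp [hEdef, hh, h2]
  have huk : ⟪E 0 0, k⟫_ℝ = 0 := by
    rw [L2.inner_def, ← hψ0]
    refine integral_congr_ae ?_
    filter_upwards [(hE 0 0).coeFn_toLp, hψc] with z _ h2
    simp [hEdef, hk, h2]
  have hhh : ⟪h, h⟫_ℝ = ∫ z, φ z.1 ^ 2 ∂P := by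
    rw [L2.inner_def]
    refine integral_congr_ae ?_
    filter_upwards [hφc] with z h1
    simp [hh, h1, pow_two]
  have hkk : ⟪k, k⟫_ℝ = ∫ z, ψ z.2 ^ 2 ∂P := by
    rw [L2.inner_def]
    refine integral_congr_ae ?_
    filter_upwards [hψc] with z h1
    simp [hk, h1, pow_two]
  have hhk : ⟪h, k⟫_ℝ = ∫ z, φ z.1 * ψ z.2 ∂P := by
    rw [L2.inner_def]
    refine integral_congr_ae ?_
    filter_upwards [hφc, hψc] with z h1 h2
    simp [hh, hk, h1, h2, mul_comm]
  rw [huh, huk, hhh, hkk, hhk] at hcov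
  simpa using hcov

end Joint

section CenteredGaussian

variable {Ω : Type*} [MeasurableSpace Ω] {μ : Measure Ω} {X : Ω → ℝ} {v : ℝ≥0}

lemma aemeasurable_of_map_eq_gaussianReal (h : μ.map X = gaussianReal 0 v) : AEMeasurable X μ := by
  have : NeZero (μ.map X) := ⟨h ▸ IsProbabilityMeasure.ne_zero _⟩
  exact aemeasurable_of_map_neZero this

lemma memLp_two_of_map_eq_gaussianReal (h : μ.map X = gaussianReal 0 v) : MemLp X 2 μ := by
  have hX := aemeasurable_of_map_eq_gaussianReal h
  have := memLp_id_gaussianReal (μ := 0) (v := v) 2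
  rw [← h] at this
  exact (memLp_map_measure_iff aestronglyMeasurable_id hX).1 this

lemma integral_sq_of_map_eq_gaussianReal (h : μ.map X = gaussianReal 0 v) :
    ∫ ω, X ω ^ 2 ∂μ = v := by
  have hX := aemeasurable_of_map_eq_gaussianReal h
  rw [← integral_map (f := fun x : ℝ => x ^ 2) hX (by fun_prop), h,
    ← variance_id_gaussianReal (μ := 0) (v := v), variance_eq_integral (by fun_prop)]
  simp

lemma integrable_exp_of_map_eq_gaussianReal (h : μ.map X = gaussianReal 0 v) :
    Integrable (fun ω => Real.exp (X ω)) μ := by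
  have hX := aemeasurable_of_map_eq_gaussianReal h
  have := integrable_exp_mul_gaussianReal (μ := 0) (v := v) 1
  rw [← h, integrable_map_measure (by fun_prop) hX] at this
  simpa [Function.comp_def] using this

lemma integral_exp_of_map_eq_gaussianReal (h : μ.map X = gaussianReal 0 v) :
    ∫ ω, Real.exp (X ω) ∂μ = Real.exp ((∫ ω, X ω ^ 2 ∂μ) / 2) := by
  have := mgf_gaussianReal h 1
  rw [integral_sq_of_map_eq_gaussianReal h]
  simpa [mgf] using this

end CenteredGaussian

/-- The second moment of a linear combination of the coordinates of two standardized vectors. -/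
lemma integral_sq_dotProduct_add_dotProduct {Ω : Type*} [MeasurableSpace Ω] {μ : Measure Ω}
    {m n : Type*} [Fintype m] [Fintype n] [DecidableEq m] [DecidableEq n]
    {X : Ω → m → ℝ} {Y : Ω → n → ℝ} {R : Matrix m n ℝ}
    (hX : ∀ i, MemLp (fun ω => X ω i) 2 μ) (hY : ∀ j, MemLp (fun ω => Y ω j) 2 μ)
    (hXX : ∀ i j, ∫ ω, X ω i * X ω j ∂μ = if i = j then 1 else 0)
    (hYY : ∀ i j, ∫ ω, Y ω i * Y ω j ∂μ = if i = j then 1 else 0)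
    (hXY : ∀ i j, ∫ ω, X ω i * Y ω j ∂μ = R i j) (a : m → ℝ) (b : n → ℝ) :
    ∫ ω, (a ⬝ᵥ X ω + b ⬝ᵥ Y ω) ^ 2 ∂μ = a ⬝ᵥ a + b ⬝ᵥ b + 2 * (a ⬝ᵥ R *ᵥ b) := by
  set Z : m ⊕ n → Ω → ℝ := Sum.elim (fun i ω => X ω i) (fun j ω => Y ω j) with hZ
  set c : m ⊕ n → ℝ := Sum.elim a b with hc
  have hZ2 : ∀ i, MemLp (Z i) 2 μ := by rintro (i | j) <;> simp [hZ, hX, hY]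
  have hsq : ∀ ω, (a ⬝ᵥ X ω + b ⬝ᵥ Y ω) ^ 2 =
      ∑ i, ∑ j, c i * c j * (Z i ω * Z j ω) := by
    intro ω
    have : a ⬝ᵥ X ω + b ⬝ᵥ Y ω = ∑ i, c i * Z i ω := by simp [hZ, hc, dotProduct]
    rw [this, pow_two, Finset.sum_mul_sum]
    exact Finset.sum_congr rfl fun i _ => Finset.sum_congr rfl fun j _ => by ring
  have hint : ∀ i j, Integrable (fun ω => c i * c j * (Z i ω * Z j ω)) μ := fun i j =>
    ((hZ2 i).integrable_mul (hZ2 j)).const_mul _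
  simp_rw [hsq]
  rw [integral_finsetSum _ fun i _ => integrable_finsetSum _ fun j _ => hint i j]
  simp_rw [integral_finsetSum _ fun j _ => hint _ j, integral_const_mul]
  have hYX : ∀ i j, ∫ ω, Y ω j * X ω i ∂μ = R i j := by simpa only [mul_comm] using hXY
  simp only [Fintype.sum_sum_type, hZ, hc, Sum.elim_inl, Sum.elim_inr, hXX, hYY, hXY, hYX]
  simp only [two_mul, mul_ite, mul_one, mul_zero, Finset.sum_ite_eq, Finset.mem_univ, if_true,
    Finset.sum_add_distrib, dotProduct, mulVec, Finset.mul_sum]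
  rw [Finset.sum_comm (s := (Finset.univ : Finset n))]
  simp only [mul_comm, mul_left_comm]
  ring

/-- **Covariance bound for centered functions of two correlated Gaussian vectors.**
For a jointly Gaussian pair of standard Gaussian vectors with cross-correlation matrix `R` of
largest singular value `s`, any centered square-integrable `φ(Yα)`, `ψ(Yβ)` satisfy
`|E[φ(Yα) ψ(Yβ)]| ≤ s ‖φ(Yα)‖₂ ‖ψ(Yβ)‖₂`. -/
theorem gaussian_covariance_bound
    {Ω : Type*} [MeasurableSpace Ω] (μ : Measure Ω) [IsProbabilityMeasure μ]
    {dα dβ : ℕ} (Yα : Ω → Fin dα → ℝ) (Yβ : Ω → Fin dβ → ℝ)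
    (hGauss : IsJointGaussianPair μ Yα Yβ)
    (hmeanα : ∀ i, ∫ ω, Yα ω i ∂μ = 0)
    (hmeanβ : ∀ j, ∫ ω, Yβ ω j ∂μ = 0)
    (hcovα : ∀ i j, ∫ ω, Yα ω i * Yα ω j ∂μ = if i = j then 1 else 0)
    (hcovβ : ∀ i j, ∫ ω, Yβ ω i * Yβ ω j ∂μ = if i = j then 1 else 0)
    (R : Matrix (Fin dα) (Fin dβ) ℝ)
    (hR : ∀ i j, R i j = ∫ ω, Yα ω i * Yβ ω j ∂μ)
    (s : ℝ) (hs0 : 0 ≤ s)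
    (hsEig : ∃ v : Fin dβ → ℝ, v ≠ 0 ∧ (R.transpose * R).mulVec v = s ^ 2 • v)
    (hsMax : ∀ (t : ℝ) (v : Fin dβ → ℝ), v ≠ 0 → (R.transpose * R).mulVec v = t • v →
      t ≤ s ^ 2)
    (φ : (Fin dα → ℝ) → ℝ) (ψ : (Fin dβ → ℝ) → ℝ)
    (hφ : Measurable φ) (hψ : Measurable ψ)
    (hcentφ : ∫ ω, φ (Yα ω) ∂μ = 0) (hcentψ : ∫ ω, ψ (Yβ ω) ∂μ = 0)
    (hLφ : Integrable (fun ω => (φ (Yα ω)) ^ 2) μ)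
    (hLψ : Integrable (fun ω => (ψ (Yβ ω)) ^ 2) μ) :
    |∫ ω, φ (Yα ω) * ψ (Yβ ω) ∂μ| ≤
      s * Real.sqrt (∫ ω, (φ (Yα ω)) ^ 2 ∂μ) * Real.sqrt (∫ ω, (ψ (Yβ ω)) ^ 2 ∂μ) := by
  have hcomb : ∀ (a : Fin dα → ℝ) (b : Fin dβ → ℝ), ∃ v : ℝ≥0,
      μ.map (fun ω => a ⬝ᵥ Yα ω + b ⬝ᵥ Yβ ω) = gaussianReal 0 v := hGauss
  have hα2 : ∀ i, MemLp (fun ω => Yα ω i) 2 μ := fun i => by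
    obtain ⟨v, hv⟩ := hcomb (Pi.single i 1) 0
    simpa using memLp_two_of_map_eq_gaussianReal hv
  have hβ2 : ∀ j, MemLp (fun ω => Yβ ω j) 2 μ := fun j => by
    obtain ⟨v, hv⟩ := hcomb 0 (Pi.single j 1)
    simpa using memLp_two_of_map_eq_gaussianReal hv
  have hαm : AEMeasurable Yα μ := aemeasurable_pi_iff.2 fun i => (hα2 i).aemeasurable
  have hβm : AEMeasurable Yβ μ := aemeasurable_pi_iff.2 fun j => (hβ2 j).aemeasurable
  have hm : AEMeasurable (fun ω => (Yα ω, Yβ ω)) μ := hαm.prodMk hβm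
  have hsq := integral_sq_dotProduct_add_dotProduct hα2 hβ2 hcovα hcovβ fun i j => (hR i j).symm
  have hs1 : s ≤ 1 := by
    obtain ⟨v, hv0, hv⟩ := hsEig
    have hvv : 0 < v ⬝ᵥ v := by simpa using dotProduct_star_self_pos_iff.2 hv0
    have hRv : R *ᵥ v ⬝ᵥ R *ᵥ v = s ^ 2 * (v ⬝ᵥ v) := by
      rw [dotProduct_mulVec, ← mulVec_transpose, mulVec_mulVec, hv, smul_dotProduct, smul_eq_mul]
    have h0 : 0 ≤ ∫ ω, (-(R *ᵥ v) ⬝ᵥ Yα ω + v ⬝ᵥ Yβ ω) ^ 2 ∂μ :=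
      integral_nonneg fun ω => sq_nonneg _
    rw [hsq] at h0
    simp only [neg_dotProduct, dotProduct_neg, neg_neg, hRv] at h0
    have : s ^ 2 ≤ 1 := le_of_mul_le_mul_right (by linarith) hvv
    exact (sq_le_one_iff₀ hs0).1 this
  set P := μ.map fun ω => (Yα ω, Yβ ω)
  have : IsProbabilityMeasure P := Measure.isProbabilityMeasure_map hm
  have hint : ∀ f : (Fin dα → ℝ) × (Fin dβ → ℝ) → ℝ, Measurable f →
      ∫ z, f z ∂P = ∫ ω, f (Yα ω, Yβ ω) ∂μ := fun f hf =>
    integral_map hm hf.aestronglyMeasurable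
  have hintble : ∀ f : (Fin dα → ℝ) × (Fin dβ → ℝ) → ℝ, Measurable f →
      Integrable (fun ω => f (Yα ω, Yβ ω)) μ → Integrable f P := fun f hf =>
    (integrable_map_measure hf.aestronglyMeasurable hm).2
  have hφ' : Measurable fun z : (Fin dα → ℝ) × (Fin dβ → ℝ) => φ z.1 := hφ.comp measurable_fst
  have hψ' : Measurable fun z : (Fin dα → ℝ) × (Fin dβ → ℝ) => ψ z.2 := hψ.comp measurable_snd
  have key := sq_integral_mul_le_of_laplace (P := P) hs0 hs1
    (posSemidef_fromBlocks_smul_one hs0 (mulVec_dotProduct_mulVec_le hsMax))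
    (fun a b => hintble _ (by fun_prop) (by
      obtain ⟨v, hv⟩ := hcomb a b
      exact integrable_exp_of_map_eq_gaussianReal hv))
    (fun a b => by
      obtain ⟨v, hv⟩ := hcomb a b
      rw [hint _ (by fun_prop), integral_exp_of_map_eq_gaussianReal hv, hsq]
      ring_nf)
    hφ hψ (by rwa [hint _ hφ']) (by rwa [hint _ hψ'])
    (hintble _ (hφ'.pow_const 2) hLφ) (hintble _ (hψ'.pow_const 2) hLψ)
  rw [hint (fun z => φ z.1 * ψ z.2) (hφ'.mul hψ'), hint (fun z => φ z.1 ^ 2) (hφ'.pow_const 2),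
    hint (fun z => ψ z.2 ^ 2) (hψ'.pow_const 2)] at key
  refine abs_le_of_sq_le_sq (key.trans_eq ?_) (by positivity)
  rw [mul_pow, mul_pow, Real.sq_sqrt (integral_nonneg fun ω => sq_nonneg _),
    Real.sq_sqrt (integral_nonneg fun ω => sq_nonneg _)]
end
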